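/- arXiv:1508.07180 — 3 statements merged into one kernel-verified Lean document; each statement's English description precedes it below -/
import Mathlib

section
/- Let α > -1/2. Then d_n(α) ∼ (n+α+1)^{n+α+1} / e^{n+α+1}, i.e. there exist constants c, C > 0 such that for all n ≥ 0, c · (n+α+1)^{n+α+1} e^{-(n+α+1)} ≤ d_n(α) ≤ C · (n+α+1)^{n+α+1} e^{-(n+α+1)}. -/
/-- `d_n(α) = 2^n ⌊n/2⌋! Γ(⌊(n+1)/2⌋ + α + 1) / Γ(α+1)`. -/
noncomputable def dunklD (α : ℝ) (n : ℕ) : ℝ :=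
  2 ^ n * (Nat.factorial (n / 2)) *
    Real.Gamma ((((n + 1) / 2 : ℕ) : ℝ) + α + 1) / Real.Gamma (α + 1)

theorem dunklD_pos {α : ℝ} (hα : -1 < α) (n : ℕ) : 0 < dunklD α n := by
  have h₁ : 0 < Real.Gamma ((((n + 1) / 2 : ℕ) : ℝ) + α + 1) :=
    Real.Gamma_pos_of_pos (by have := Nat.cast_nonneg (α := ℝ) ((n + 1) / 2); linarith)
  have h₂ : 0 < Real.Gamma (α + 1) := Real.Gamma_pos_of_pos (by linarith)
  have h₃ : (0 : ℝ) < Nat.factorial (n / 2) := mod_cast Nat.factorial_pos _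
  unfold dunklD
  positivity

theorem dunklD_add_two {α : ℝ} (hα : -1 < α) (n : ℕ) :
    dunklD α (n + 2) =
      dunklD α n * (4 * (((n / 2 : ℕ) : ℝ) + 1) * ((((n + 1) / 2 : ℕ) : ℝ) + α + 1)) := by
  have hk : (((n + 1) / 2 : ℕ) : ℝ) + α + 1 ≠ 0 := by
    have := Nat.cast_nonneg (α := ℝ) ((n + 1) / 2)
    linarith
  have h₁ : (n + 2) / 2 = n / 2 + 1 := by omega
  have h₂ : (n + 2 + 1) / 2 = (n + 1) / 2 + 1 := by omega
  have h₃ : (((n + 1) / 2 + 1 : ℕ) : ℝ) + α + 1 = (((n + 1) / 2 : ℕ) : ℝ) + α + 1 + 1 := by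
    push_cast
    ring
  unfold dunklD
  rw [h₁, h₂, h₃, Real.Gamma_add_one hk, Nat.factorial_succ]
  push_cast
  ring

/-- The quotient `d_{n+2}(α) / d_n(α)` is a perturbation of `(n + α + 2) ^ 2`. -/
theorem exists_dunklD_add_two_eq {α : ℝ} (hα : -1/2 < α) (n : ℕ) :
    ∃ b : ℝ, |b| ≤ |α| + 1 ∧
      ((n : ℝ) + 1) * (n + 2) ≤ ((n : ℝ) + α + 2) ^ 2 - b ^ 2 ∧
      dunklD α (n + 2) = dunklD α n * (((n : ℝ) + α + 2) ^ 2 - b ^ 2) := by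
  rw [dunklD_add_two (by linarith)]
  obtain ⟨k, rfl | rfl⟩ := n.even_or_odd'
  · have h₁ : 2 * k / 2 = k := by omega
    have h₂ : (2 * k + 1) / 2 = k := by omega
    have hk := Nat.cast_nonneg (α := ℝ) k
    refine ⟨α, by linarith, ?_, ?_⟩
    · push_cast
      nlinarith
    · rw [h₁, h₂]
      push_cast
      ring
  · have h₁ : (2 * k + 1) / 2 = k := by omega
    have h₂ : (2 * k + 1 + 1) / 2 = k + 1 := by omega
    have hk := Nat.cast_nonneg (α := ℝ) k
    refine ⟨α + 1, (abs_add_le _ _).trans (by simp), ?_, ?_⟩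
    · push_cast
      nlinarith
    · rw [h₁, h₂]
      push_cast
      ring

theorem two_le_mul_log_add_one_sub_log_sub_one {y : ℝ} (hy : 1 < y) :
    2 ≤ y * (Real.log (y + 1) - Real.log (y - 1)) := by
  have hy₀ : 0 < y := by linarith
  have h := Real.sum_range_le_log_div (x := y⁻¹) (by positivity) (inv_lt_one_of_one_lt₀ hy) 1
  have e : (1 + y⁻¹) / (1 - y⁻¹) = (y + 1) / (y - 1) := by
    have : y - 1 ≠ 0 := by linarith
    field_simp
  rw [e, Real.log_div (by linarith) (by linarith)] at h
  simp at h
  have := mul_le_mul_of_nonneg_left h hy₀.le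
  rw [mul_inv_cancel₀ hy₀.ne'] at this
  linarith

theorem mul_log_add_one_sub_log_sub_one_le {y : ℝ} (hy : 1 < y) :
    y * (Real.log (y + 1) - Real.log (y - 1)) ≤ 2 + 2 / (y ^ 2 - 1) := by
  have hy₀ : 0 < y := by linarith
  have h := Real.log_div_le_sum_range_add (x := y⁻¹) (by positivity) (inv_lt_one_of_one_lt₀ hy) 0
  have hy₁ : y - 1 ≠ 0 := by linarith
  have hy₂ : y ^ 2 - 1 ≠ 0 := by nlinarith
  have e : (1 + y⁻¹) / (1 - y⁻¹) = (y + 1) / (y - 1) := by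
    field_simp
  rw [e, Real.log_div (by linarith) (by linarith)] at h
  simp at h
  have := mul_le_mul_of_nonneg_left h hy₀.le
  have e₂ : y * (y⁻¹ / (1 - (y ^ 2)⁻¹)) = 1 + 1 / (y ^ 2 - 1) := by
    field_simp
    ring
  rw [e₂] at this
  have e₃ : 2 / (y ^ 2 - 1) = 2 * (1 / (y ^ 2 - 1)) := by ring
  linarith

theorem log_sq_sub_sq_le {y b : ℝ} (h : 0 < y ^ 2 - b ^ 2) :
    Real.log (y ^ 2 - b ^ 2) ≤ 2 * Real.log y := by
  have := Real.log_le_log h (show y ^ 2 - b ^ 2 ≤ y ^ 2 by nlinarith [sq_nonneg b])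
  simpa [Real.log_pow] using this

theorem le_log_sq_sub_sq {y b : ℝ} (h : 0 < y ^ 2 - b ^ 2) :
    2 * Real.log y - b ^ 2 / (y ^ 2 - b ^ 2) ≤ Real.log (y ^ 2 - b ^ 2) := by
  have hy : 0 < y ^ 2 := by nlinarith [sq_nonneg b]
  have := Real.one_sub_inv_le_log_of_pos (div_pos h hy)
  rw [Real.log_div h.ne' hy.ne', Real.log_pow] at this
  have e : 1 - ((y ^ 2 - b ^ 2) / y ^ 2)⁻¹ = -(b ^ 2 / (y ^ 2 - b ^ 2)) := by
    field_simp
    ring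
  rw [e] at this
  push_cast at this
  linarith

/-- The logarithm of `d_n(α) / (x ^ x * exp (-x))` with `x = n + α + 1`. -/
noncomputable def logDunklRatio (α : ℝ) (n : ℕ) : ℝ :=
  Real.log (dunklD α n) - (((n : ℝ) + α + 1) * Real.log ((n : ℝ) + α + 1) - ((n : ℝ) + α + 1))

theorem abs_logDunklRatio_add_two_sub_le {α : ℝ} (hα : -1/2 < α) (n : ℕ) :
    |logDunklRatio α (n + 2) - logDunklRatio α n| ≤
      ((|α| + 1) ^ 2 + 4) * (1 / ((n : ℝ) + 1) - 1 / ((n : ℝ) + 2)) := by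
  obtain ⟨b, hb, hP, hd⟩ := exists_dunklD_add_two_eq hα n
  have hn := Nat.cast_nonneg (α := ℝ) n
  have hQ : ((n : ℝ) + 1) * (n + 2) / 2 ≤ ((n : ℝ) + α + 2) ^ 2 - 1 ^ 2 := by nlinarith
  have hN : 0 < ((n : ℝ) + 1) * (n + 2) := by positivity
  have hP₀ := hN.trans_le hP
  have hQ₀ := (half_pos hN).trans_le hQ
  unfold logDunklRatio
  rw [hd, Real.log_mul (dunklD_pos (by linarith) n).ne' hP₀.ne']
  have hy : 1 < (n : ℝ) + α + 2 := by linarith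
  have ea : ((n + 2 : ℕ) : ℝ) + α + 1 = (n + α + 2) + 1 := by push_cast; ring
  have eb : (n : ℝ) + α + 1 = (n + α + 2) - 1 := by ring
  rw [ea, eb]
  generalize (n : ℝ) + α + 2 = y at *
  have hlog : Real.log (y ^ 2 - 1 ^ 2) = Real.log (y + 1) + Real.log (y - 1) := by
    rw [← Real.log_mul (by linarith) (by linarith)]
    ring_nf
  have h₁ := two_le_mul_log_add_one_sub_log_sub_one hy
  have h₂ := mul_log_add_one_sub_log_sub_one_le hy
  have h₃ := log_sq_sub_sq_le hP₀
  have h₄ := le_log_sq_sub_sq hP₀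
  have h₅ := log_sq_sub_sq_le hQ₀
  have h₆ := le_log_sq_sub_sq hQ₀
  rw [hlog] at h₅ h₆
  have hb₂ : b ^ 2 ≤ (|α| + 1) ^ 2 := by
    rw [← sq_abs b]
    gcongr
  have b₁ : b ^ 2 / (y ^ 2 - b ^ 2) ≤ (|α| + 1) ^ 2 / (((n : ℝ) + 1) * (n + 2)) := by gcongr
  have b₂ : 1 / (y ^ 2 - 1 ^ 2) ≤ 2 / (((n : ℝ) + 1) * (n + 2)) := by
    rw [div_le_div_iff₀ hQ₀ hN]
    linarith
  have e₁ : ((|α| + 1) ^ 2 + 4) * (1 / ((n : ℝ) + 1) - 1 / ((n : ℝ) + 2)) =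
      (|α| + 1) ^ 2 / (((n : ℝ) + 1) * (n + 2)) + 2 * (2 / (((n : ℝ) + 1) * (n + 2))) := by
    field_simp
    ring
  have e₂ : 2 / (y ^ 2 - 1) = 2 * (1 / (y ^ 2 - 1 ^ 2)) := by
    rw [one_pow]
    ring
  have b₃ : 0 ≤ (|α| + 1) ^ 2 / (((n : ℝ) + 1) * (n + 2)) := by positivity
  have b₄ : 0 ≤ 2 / (((n : ℝ) + 1) * (n + 2)) := by positivity
  rw [e₂] at h₂
  norm_num only [one_pow] at h₆ b₂ h₂
  rw [e₁, abs_le]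
  constructor <;> linarith

theorem abs_logDunklRatio_le {α : ℝ} (hα : -1/2 < α) (n : ℕ) :
    |logDunklRatio α n| ≤ |logDunklRatio α 0| + |logDunklRatio α 1| +
      ((|α| + 1) ^ 2 + 4) * (1 - 1 / ((n : ℝ) + 1)) := by
  induction n using Nat.twoStepInduction with
  | zero => simp
  | one =>
    have : 0 ≤ ((|α| + 1) ^ 2 + 4) * (1 - 1 / (((1 : ℕ) : ℝ) + 1)) := by
      norm_num
      positivity
    linarith [abs_nonneg (logDunklRatio α 0)]
  | more n ih _ =>
    have h := abs_logDunklRatio_add_two_sub_le hα n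
    have h' := abs_sub_abs_le_abs_sub (logDunklRatio α (n + 2)) (logDunklRatio α n)
    have hm : ((|α| + 1) ^ 2 + 4) * (1 / (((n + 2 : ℕ) : ℝ) + 1)) ≤
        ((|α| + 1) ^ 2 + 4) * (1 / ((n : ℝ) + 2)) := by
      have hn := Nat.cast_nonneg (α := ℝ) n
      push_cast
      exact mul_le_mul_of_nonneg_left (one_div_le_one_div_of_le (by linarith) (by linarith))
        (by positivity)
    linarith

/-- For `α > -1/2`, `d_n(α) ∼ (n+α+1)^(n+α+1) / e^(n+α+1)`. -/
theorem dunklD_asymptotics (α : ℝ) (hα : -1/2 < α) :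
    ∃ c C : ℝ, 0 < c ∧ 0 < C ∧ ∀ n : ℕ,
      c * ((n : ℝ) + α + 1) ^ ((n : ℝ) + α + 1) * Real.exp (-((n : ℝ) + α + 1))
        ≤ dunklD α n ∧
      dunklD α n ≤
        C * ((n : ℝ) + α + 1) ^ ((n : ℝ) + α + 1) * Real.exp (-((n : ℝ) + α + 1)) := by
  obtain ⟨M, hM⟩ : ∃ M, ∀ n, |logDunklRatio α n| ≤ M := by
    refine ⟨|logDunklRatio α 0| + |logDunklRatio α 1| + ((|α| + 1) ^ 2 + 4) * 1, fun n => ?_⟩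
    refine (abs_logDunklRatio_le hα n).trans ?_
    gcongr
    have : 0 ≤ 1 / ((n : ℝ) + 1) := by positivity
    linarith
  refine ⟨Real.exp (-M), Real.exp M, Real.exp_pos _, Real.exp_pos _, fun n => ?_⟩
  have hx : 0 < (n : ℝ) + α + 1 := by
    have := Nat.cast_nonneg (α := ℝ) n
    linarith
  obtain ⟨h₁, h₂⟩ := abs_le.mp (hM n)
  unfold logDunklRatio at h₁ h₂
  rw [Real.rpow_def_of_pos hx, ← Real.exp_add, ← Real.exp_add, ← Real.exp_add, ← Real.exp_add,
    ← Real.le_log_iff_exp_le (dunklD_pos (by linarith) n),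
    ← Real.log_le_iff_le_exp (dunklD_pos (by linarith) n)]
  constructor <;> linarith
end

section
/- Let α > -1/2 and let f : ℂ → ℂ be an entire function. Then for every n ∈ ℕ, the value of the n-th iterate of the Dunkl operator at 0 is Λ_α^n f(0) = (f^{(n)}(0)/n!) · d_n(α). -/
/-- The Dunkl operator `Λ_α`. -/
noncomputable def dunkl (α : ℝ) (f : ℂ → ℂ) : ℂ → ℂ := fun z =>
  if z = 0 then (2 * (α : ℂ) + 2) * deriv f 0
  else deriv f z + ((2 * (α : ℂ) + 1) / z) * ((f z - f (-z)) / 2)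

lemma dunkl_eq_deriv_add_dslope (α : ℝ) {f : ℂ → ℂ} (hf : Differentiable ℂ f) :
    dunkl α f = deriv f + fun z =>
      (2 * (α : ℂ) + 1) * dslope (fun w => 2⁻¹ * (f w - f (-w))) 0 z := by
  funext z
  by_cases hz : z = 0
  · subst hz
    have hneg : HasDerivAt (fun w : ℂ => f (-w)) (-deriv f 0) 0 := by
      simpa [Function.comp_def] using (hf (-0)).hasDerivAt.comp (0 : ℂ) (hasDerivAt_neg (0 : ℂ))
    have hodd := ((hf 0).hasDerivAt.sub hneg).const_mul (2⁻¹ : ℂ)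
    have hderiv : deriv (fun w => 2⁻¹ * (f w - f (-w))) 0 = 2⁻¹ * (deriv f 0 - -deriv f 0) :=
      hodd.deriv
    simp only [dunkl, if_true, Pi.add_apply, dslope_same, hderiv]
    ring
  · simp only [dunkl, if_neg hz, Pi.add_apply, dslope_of_ne _ hz, slope_def_field, neg_zero,
      sub_self, mul_zero, sub_zero]
    ring

lemma differentiable_dslope {f : ℂ → ℂ} (hf : Differentiable ℂ f) (c : ℂ) :
    Differentiable ℂ (dslope f c) :=
  differentiableOn_univ.1 ((Complex.differentiableOn_dslope Filter.univ_mem).2 hf.differentiableOn)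

lemma differentiable_iteratedDeriv {f : ℂ → ℂ} (hf : Differentiable ℂ f) (n : ℕ) :
    Differentiable ℂ (iteratedDeriv n f) :=
  (hf.contDiff (n := ⊤)).differentiable_iteratedDeriv n (by exact_mod_cast WithTop.coe_lt_top _)

lemma iteratedDeriv_succ_id_mul {h : ℂ → ℂ} (hh : Differentiable ℂ h) (n : ℕ) :
    iteratedDeriv (n + 1) (fun z => z * h z) =
      fun z => z * iteratedDeriv (n + 1) h z + (n + 1) * iteratedDeriv n h z := by
  have hderiv (k : ℕ) (z : ℂ) :
      HasDerivAt (iteratedDeriv k h) (iteratedDeriv (k + 1) h z) z := by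
    rw [iteratedDeriv_succ]
    exact (differentiable_iteratedDeriv hh k z).hasDerivAt
  induction n with
  | zero =>
    funext z
    rw [iteratedDeriv_one]
    refine ((hasDerivAt_id z).mul (hderiv 0 z)).deriv.trans ?_
    simp [add_comm]
  | succ n ih =>
    funext z
    rw [iteratedDeriv_succ, ih]
    refine (((hasDerivAt_id z).mul (hderiv (n + 1) z)).add
      ((hderiv n z).const_mul ((n : ℂ) + 1))).deriv.trans ?_
    simp only [id]
    push_cast
    ring

lemma iteratedDeriv_dslope_zero {g : ℂ → ℂ} (hg : Differentiable ℂ g) (h0 : g 0 = 0) (n : ℕ) :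
    (n + 1) * iteratedDeriv n (dslope g 0) 0 = iteratedDeriv (n + 1) g 0 := by
  have hfactor : (fun z => z * dslope g 0 z) = g := by
    funext z
    simpa [h0] using sub_smul_dslope g 0 z
  conv_rhs => rw [← hfactor, iteratedDeriv_succ_id_mul (differentiable_dslope hg 0)]
  simp

lemma iteratedDeriv_dunkl_zero (α : ℝ) {f : ℂ → ℂ} (hf : Differentiable ℂ f) (n : ℕ) :
    (n + 1) * iteratedDeriv n (dunkl α f) 0 =
      (n + 1 + (2 * α + 1) * ((1 + (-1) ^ n) / 2)) * iteratedDeriv (n + 1) f 0 := by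
  have hneg : Differentiable ℂ fun w => f (-w) := hf.comp differentiable_neg
  have hodd : Differentiable ℂ fun w => 2⁻¹ * (f w - f (-w)) := (hf.sub hneg).const_mul _
  have hslope := differentiable_dslope hodd 0
  have hcoeff := iteratedDeriv_dslope_zero hodd (by simp) n
  have hoddDeriv : iteratedDeriv (n + 1) (fun w => 2⁻¹ * (f w - f (-w))) 0 =
      2⁻¹ * (iteratedDeriv (n + 1) f 0 - (-1) ^ (n + 1) * iteratedDeriv (n + 1) f 0) := by
    rw [iteratedDeriv_const_mul_field, iteratedDeriv_fun_sub hf.contDiff.contDiffAt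
      hneg.contDiff.contDiffAt, iteratedDeriv_comp_neg]
    simp
  rw [hoddDeriv] at hcoeff
  have hderiv : Differentiable ℂ (deriv f) := by
    simpa using differentiable_iteratedDeriv hf 1
  rw [dunkl_eq_deriv_add_dslope α hf, iteratedDeriv_add hderiv.contDiff.contDiffAt
    (hslope.const_mul _).contDiff.contDiffAt, iteratedDeriv_const_mul_field, ← iteratedDeriv_succ']
  linear_combination (2 * (α : ℂ) + 1) * hcoeff

lemma differentiable_dunkl (α : ℝ) {f : ℂ → ℂ} (hf : Differentiable ℂ f) :
    Differentiable ℂ (dunkl α f) := by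
  rw [dunkl_eq_deriv_add_dslope α hf]
  have hderiv : Differentiable ℂ (deriv f) := by
    simpa using differentiable_iteratedDeriv hf 1
  exact hderiv.add ((differentiable_dslope
    ((hf.sub (hf.comp differentiable_neg)).const_mul _) 0).const_mul _)

lemma dunklD_zero {α : ℝ} (hα : -1 < α) : dunklD α 0 = 1 := by
  have hΓ : Real.Gamma (α + 1) ≠ 0 := (Real.Gamma_pos_of_pos (by linarith)).ne'
  simp [dunklD, hΓ]

lemma dunklD_succ {α : ℝ} (hα : -1 < α) (n : ℕ) :
    dunklD α (n + 1) = (n + 1 + (2 * α + 1) * ((1 + (-1) ^ n) / 2)) * dunklD α n := by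
  obtain ⟨k, rfl | rfl⟩ := n.even_or_odd'
  · have hk : (k : ℝ) + α + 1 ≠ 0 := by
      have : (0 : ℝ) ≤ k := k.cast_nonneg
      linarith
    have h₁ : (2 * k + 1) / 2 = k := by omega
    have h₂ : (2 * k + 1 + 1) / 2 = k + 1 := by omega
    have h₃ : 2 * k / 2 = k := by omega
    have hΓ : Real.Gamma (((k + 1 : ℕ) : ℝ) + α + 1) =
        ((k : ℝ) + α + 1) * Real.Gamma ((k : ℝ) + α + 1) := by
      rw [← Real.Gamma_add_one hk]
      push_cast
      ring_nf
    simp only [dunklD, h₁, h₂, h₃, hΓ, pow_mul, pow_succ]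
    push_cast
    norm_num
    ring
  · have h₁ : (2 * k + 1) / 2 = k := by omega
    have h₂ : (2 * k + 1 + 1) / 2 = k + 1 := by omega
    have h₃ : (2 * k + 1 + 1 + 1) / 2 = k + 1 := by omega
    simp only [dunklD, h₁, h₂, h₃, Nat.factorial_succ, pow_succ, pow_mul]
    push_cast
    norm_num
    ring

/-- For an entire function `f`, `Λ_α^n f(0) = (f^(n)(0)/n!) d_n(α)`. -/
theorem dunkl_iterate_apply_zero (α : ℝ) (hα : -1/2 < α) (f : ℂ → ℂ)
    (hf : Differentiable ℂ f) (n : ℕ) :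
    (dunkl α)^[n] f 0 =
      (iteratedDeriv n f 0 / (Nat.factorial n : ℂ)) * ((dunklD α n : ℝ) : ℂ) := by
  have hα' : -1 < α := by linarith
  induction n generalizing f with
  | zero => simp [dunklD_zero hα']
  | succ n ih =>
    have hn : (n : ℂ) + 1 ≠ 0 := Nat.cast_add_one_ne_zero n
    have hfact : (n.factorial : ℂ) ≠ 0 := by exact_mod_cast n.factorial_ne_zero
    rw [Function.iterate_succ_apply, ih _ (differentiable_dunkl α hf), dunklD_succ hα',
      Nat.factorial_succ]
    push_cast
    rw [div_mul_eq_mul_div, div_mul_eq_mul_div, div_eq_div_iff hfact (mul_ne_zero hn hfact)]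
    linear_combination (n.factorial : ℂ) * dunklD α n * iteratedDeriv_dunkl_zero α hf n
end

section
/- Let 0 < α ≤ 2, θ > 0 and β ∈ ℝ, and define E_α(z; θ, β) = Σ_{n=0}^∞ z^n / ((n+θ)^β Γ(αn+1)). Then E_α(r; θ, β) = α^{β-1} r^{-β/α} e^{r^{1/α}} (1 + O(r^{-1/α})) as r → +∞; in particular, there exist constants C > 0 and R > 0 such that E_α(r; θ, β) ≤ C · r^{-β/α} e^{r^{1/α}} for all r ≥ R. -/
open Filter Asymptotics

namespace Real

lemma Gamma_add_le_Gamma_mul_rpow {s b : ℝ} (hs : 0 < s) (hb0 : 0 ≤ b) (hb1 : b ≤ 1) :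
    Gamma (s + b) ≤ Gamma s * s ^ b := by
  rcases hb0.eq_or_lt with rfl | hb0
  · simp
  rcases hb1.eq_or_lt with rfl | hb1
  · rw [Gamma_add_one hs.ne', rpow_one, mul_comm]
  have h := Gamma_mul_add_mul_le_rpow_Gamma_mul_rpow_Gamma hs (by linarith : 0 < s + 1)
    (sub_pos.2 hb1) hb0 (by ring)
  have hG := Gamma_pos_of_pos hs
  rw [Gamma_add_one hs.ne', mul_rpow hs.le hG.le] at h
  calc Gamma (s + b) = Gamma ((1 - b) * s + b * (s + 1)) := by ring_nf
    _ ≤ _ := h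
    _ = (Gamma s ^ (1 - b) * Gamma s ^ b) * s ^ b := by ring
    _ = _ := by rw [← rpow_add hG]; simp

lemma Gamma_mul_rpow_le {s b : ℝ} (hs : 0 < s) (hb0 : 0 ≤ b) (hb1 : b ≤ 1) :
    Gamma s * s ^ b ≤ (1 + (1 - b) * (b / s)) * Gamma (s + b) := by
  have h := Gamma_add_le_Gamma_mul_rpow (s := s + b) (b := 1 - b) (by linarith) (by linarith)
    (by linarith)
  rw [show s + b + (1 - b) = s + 1 by ring, Gamma_add_one hs.ne',
    show s + b = s * (1 + b / s) by field_simp, mul_rpow hs.le (by positivity),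
    show s * (1 + b / s) = s + b by field_simp] at h
  have h2 : (1 + b / s) ^ (1 - b) ≤ 1 + (1 - b) * (b / s) :=
    rpow_one_add_le_one_add_mul_self (by have : 0 ≤ b / s := by positivity
                                         linarith) (by linarith) (by linarith)
  have hG := Gamma_pos_of_pos (by linarith : 0 < s + b)
  have hp : 0 < s ^ (1 - b) := rpow_pos_of_pos hs _
  have h3 : s ^ (1 - b) * s ^ b = s := by rw [← rpow_add hs]; simp
  refine le_of_mul_le_mul_left ?_ hp
  calc s ^ (1 - b) * (Gamma s * s ^ b) = (s ^ (1 - b) * s ^ b) * Gamma s := by ring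
    _ = s * Gamma s := by rw [h3]
    _ ≤ _ := h
    _ ≤ Gamma (s + b) * (s ^ (1 - b) * (1 + (1 - b) * (b / s))) := by gcongr
    _ = _ := by ring

/-- Gautschi-type bounds for ratios of Gamma values at distance at most two. -/
lemma Gamma_add_bounds {s b : ℝ} (hs : 0 < s) (hb0 : 0 ≤ b) (hb2 : b ≤ 2) :
    Gamma (s + b) ≤ (1 + 1 / s) * (Gamma s * s ^ b) ∧
      Gamma s * s ^ b ≤ (1 + 1 / s) * Gamma (s + b) := by
  have hG := Gamma_pos_of_pos hs
  have hGb := Gamma_pos_of_pos (by linarith : 0 < s + b)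
  have hs1 : 0 < 1 / s := by positivity
  rcases le_total b 1 with hb1 | hb1
  · have h1 := Gamma_add_le_Gamma_mul_rpow hs hb0 hb1
    have h2 := Gamma_mul_rpow_le hs hb0 hb1
    constructor
    · refine h1.trans (le_mul_of_one_le_left (by positivity) (by linarith))
    · refine h2.trans ?_
      gcongr
      rw [← mul_div_assoc]
      gcongr
      nlinarith
  · have h1 := Gamma_add_le_Gamma_mul_rpow (b := b - 1) hs (by linarith) (by linarith)
    have h2 := Gamma_mul_rpow_le (b := b - 1) hs (by linarith) (by linarith)
    have hG1 := Gamma_pos_of_pos (by linarith : 0 < s + (b - 1))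
    have e : Gamma (s + b) = (s + (b - 1)) * Gamma (s + (b - 1)) := by
      rw [← Gamma_add_one (by linarith)]; ring_nf
    have e2 : s ^ b = s * s ^ (b - 1) := by
      rw [← rpow_one_add' hs.le (by linarith)]; ring_nf
    have hp : 0 < s ^ (b - 1) := rpow_pos_of_pos hs _
    rw [e, e2]
    constructor
    · calc (s + (b - 1)) * Gamma (s + (b - 1)) ≤ (s + 1) * (Gamma s * s ^ (b - 1)) := by
            gcongr; linarith
        _ = _ := by field_simp
    · calc Gamma s * (s * s ^ (b - 1)) = s * (Gamma s * s ^ (b - 1)) := by ring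
        _ ≤ s * ((1 + (1 - (b - 1)) * ((b - 1) / s)) * Gamma (s + (b - 1))) := by gcongr
        _ = (s + (2 - b) * (b - 1)) * Gamma (s + (b - 1)) := by field_simp; ring
        _ ≤ (s + (b - 1)) * Gamma (s + (b - 1)) := by gcongr; nlinarith
        _ ≤ _ := le_mul_of_one_le_left (mul_nonneg (by linarith) hG1.le) (by linarith)

end Real

/-- The continuous interpolation `x ^ s / Γ(s + 1)` of the terms of the exponential series. -/
noncomputable def powDivGamma (x s : ℝ) : ℝ := x ^ s / Real.Gamma (s + 1)

lemma powDivGamma_pos {x s : ℝ} (hx : 0 < x) (hs : 0 ≤ s) : 0 < powDivGamma x s :=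
  div_pos (Real.rpow_pos_of_pos hx _) (Real.Gamma_pos_of_pos (by linarith))

lemma powDivGamma_add_one {x s : ℝ} (hx : 0 < x) (hs : 0 ≤ s) :
    powDivGamma x (s + 1) = powDivGamma x s * (x / (s + 1)) := by
  have := (Real.Gamma_pos_of_pos (by linarith : 0 < s + 1)).ne'
  rw [powDivGamma, powDivGamma, Real.Gamma_add_one (by linarith : s + 1 ≠ 0),
    Real.rpow_add_one hx.ne']
  field_simp

lemma powDivGamma_add_bounds {x s d : ℝ} (hx : 0 < x) (hs : 0 ≤ s) (hd0 : 0 ≤ d) (hd2 : d ≤ 2) :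
    powDivGamma x (s + d) ≤ (1 + 1 / (s + 1)) * (powDivGamma x s * (x / (s + 1)) ^ d) ∧
      powDivGamma x s * (x / (s + 1)) ^ d ≤ (1 + 1 / (s + 1)) * powDivGamma x (s + d) := by
  have hs' : 0 < s + 1 := by linarith
  obtain ⟨h1, h2⟩ := Real.Gamma_add_bounds hs' hd0 hd2
  have hG := Real.Gamma_pos_of_pos hs'
  have hGd := Real.Gamma_pos_of_pos (by linarith : 0 < s + 1 + d)
  have hp : 0 < (s + 1) ^ d := Real.rpow_pos_of_pos hs' _
  have hxd : 0 < x ^ (s + d) := Real.rpow_pos_of_pos hx _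
  have e : powDivGamma x s * (x / (s + 1)) ^ d
      = x ^ (s + d) / (Real.Gamma (s + 1) * (s + 1) ^ d) := by
    rw [powDivGamma, Real.div_rpow hx.le hs'.le, Real.rpow_add hx]
    field_simp
  rw [e, powDivGamma, show s + d + 1 = s + 1 + d by ring]
  constructor
  · rw [← mul_div_assoc, div_le_div_iff₀ hGd (by positivity)]
    nlinarith
  · rw [← mul_div_assoc, div_le_div_iff₀ (by positivity) hGd]
    nlinarith

lemma abs_chord_sub_rpow_le {y t : ℝ} (hy : 0 < y) (ht0 : 0 ≤ t) (ht1 : t ≤ 1) :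
    |y ^ t - ((1 - t) + t * y)| ≤ (y - 1) ^ 2 := by
  have h1 : y ^ t ≤ (1 - t) + t * y := by
    have := rpow_one_add_le_one_add_mul_self (s := y - 1) (by linarith) ht0 ht1
    rw [show 1 + (y - 1) = y by ring] at this
    linarith
  have h2 : (y⁻¹) ^ t ≤ (1 - t) + t * y⁻¹ := by
    have := rpow_one_add_le_one_add_mul_self (s := y⁻¹ - 1)
      (by have := inv_pos.2 hy; linarith) ht0 ht1
    rw [show 1 + (y⁻¹ - 1) = y⁻¹ by ring] at this
    linarith
  rw [Real.inv_rpow hy.le] at h2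
  have hp : 0 < y ^ t := Real.rpow_pos_of_pos hy _
  have h3 : y ≤ y ^ t * ((1 - t) * y + t) := by
    have := mul_le_mul_of_nonneg_left h2 (mul_pos hy hp).le
    rw [show y * y ^ t * (y ^ t)⁻¹ = y by field_simp] at this
    calc y ≤ _ := this
      _ = _ := by field_simp
  rw [abs_sub_comm, abs_of_nonneg (by linarith)]
  rcases ht0.eq_or_lt with rfl | ht0
  · simp; positivity
  have hD : 0 < (1 - t) * y + t := by nlinarith
  refine le_of_mul_le_mul_right ?_ hD
  have h4 : ((1 - t) + t * y) * ((1 - t) * y + t) - y = t * (1 - t) * (y - 1) ^ 2 := by ring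
  have h5 : t * (1 - t) * (y - 1) ^ 2 ≤ (y - 1) ^ 2 * ((1 - t) * y + t) := by
    rw [mul_comm]
    gcongr
    nlinarith
  nlinarith

lemma abs_powDivGamma_sub_chord_le {x s a t : ℝ} (hx : 0 < x) (hs : 0 ≤ s) (ha0 : 0 < a)
    (ha2 : a ≤ 2) (ht0 : 0 ≤ t) (ht1 : t ≤ 1) :
    |powDivGamma x (s + t * a) - ((1 - t) * powDivGamma x s + t * powDivGamma x (s + a))| ≤
      powDivGamma x s - 2 * powDivGamma x (s + a) + powDivGamma x (s + 2 * a) +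
        35 / (s + 1) * (powDivGamma x s + powDivGamma x (s + a) + powDivGamma x (s + 2 * a)) := by
  have hs' : 0 < s + 1 := by linarith
  have hw0 : 0 < 1 / (s + 1) := by positivity
  have hw1 : 1 / (s + 1) ≤ 1 := by rw [div_le_one hs']; linarith
  have hta0 : 0 ≤ t * a := by positivity
  have hta2 : t * a ≤ 2 := by nlinarith
  have hv : 0 < x / (s + 1) := by positivity
  have hv' : 0 < x / (s + a + 1) := by positivity
  obtain ⟨m1, m2⟩ := powDivGamma_add_bounds hx hs hta0 hta2
  obtain ⟨b1, b2⟩ := powDivGamma_add_bounds hx hs ha0.le ha2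
  obtain ⟨-, e2⟩ := powDivGamma_add_bounds hx (by linarith : 0 ≤ s + a) ha0.le ha2
  rw [show s + a + a = s + 2 * a by ring] at e2
  rw [mul_comm t a, Real.rpow_mul hv.le, mul_comm a t] at m1 m2
  have hy : 0 < (x / (s + 1)) ^ a := Real.rpow_pos_of_pos hv _
  have hy' : 0 < (x / (s + a + 1)) ^ a := Real.rpow_pos_of_pos hv' _
  have hyy : (x / (s + 1)) ^ a ≤ (1 + 8 * (1 / (s + 1))) * (x / (s + a + 1)) ^ a := by
    have e : x / (s + 1) = (1 + a * (1 / (s + 1))) * (x / (s + a + 1)) := by field_simp; ring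
    rw [e, Real.mul_rpow (by positivity) hv'.le]
    gcongr
    calc (1 + a * (1 / (s + 1))) ^ a ≤ (1 + a * (1 / (s + 1))) ^ (2 : ℝ) :=
          Real.rpow_le_rpow_of_exponent_le (by have := mul_pos ha0 hw0; linarith) ha2
      _ = (1 + a * (1 / (s + 1))) ^ 2 := Real.rpow_ofNat _ _
      _ ≤ (1 + 2 * (1 / (s + 1))) ^ 2 := by gcongr
      _ ≤ _ := by nlinarith
  have ew : 1 / (s + a + 1) ≤ 1 / (s + 1) := by gcongr; linarith
  have chord := abs_chord_sub_rpow_le hy ht0 ht1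
  have hyt : 0 < ((x / (s + 1)) ^ a) ^ t := Real.rpow_pos_of_pos hy _
  have ha := powDivGamma_pos hx hs
  have hb := powDivGamma_pos hx (by linarith : 0 ≤ s + a)
  have he := powDivGamma_pos hx (by linarith : 0 ≤ s + 2 * a)
  have hm := powDivGamma_pos hx (by linarith : 0 ≤ s + t * a)
  have hytle : ((x / (s + 1)) ^ a) ^ t ≤ 1 - t + t * (x / (s + 1)) ^ a := by
    have := rpow_one_add_le_one_add_mul_self (s := (x / (s + 1)) ^ a - 1) (by linarith) ht0 ht1
    rw [show 1 + ((x / (s + 1)) ^ a - 1) = (x / (s + 1)) ^ a by ring] at this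
    linarith
  rw [show 35 / (s + 1) = 35 * (1 / (s + 1)) by ring]
  generalize 1 / (s + a + 1) = w' at *
  generalize 1 / (s + 1) = w at *
  generalize (x / (s + a + 1)) ^ a = y' at *
  generalize (x / (s + 1)) ^ a = y at *
  generalize y ^ t = z at *
  generalize powDivGamma x (s + t * a) = M at *
  generalize powDivGamma x (s + 2 * a) = E at *
  generalize powDivGamma x (s + a) = B at *
  generalize powDivGamma x s = A at *
  have hAy : A * y ≤ 2 * B := by nlinarith
  have hAz : A * z ≤ A + 2 * B := by
    have : z ≤ 1 + y := by nlinarith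
    nlinarith
  have hAz0 : 0 < A * z := by positivity
  have h1 : |M - A * z| ≤ 2 * w * (A + 2 * B) := by
    have : w * (A * z) ≤ w * (A + 2 * B) := by gcongr
    have hwM : w * M ≤ w * (2 * (A * z)) := by
      gcongr; nlinarith
    rw [abs_le]; constructor <;> nlinarith
  have h2 : |A * z - ((1 - t) * A + t * (A * y))| ≤ A * (y - 1) ^ 2 := by
    rw [show A * z - ((1 - t) * A + t * (A * y)) = A * (z - ((1 - t) + t * y)) by ring, abs_mul,
      abs_of_pos ha]
    gcongr
  have h3 : |A * y - B| ≤ 2 * w * B := by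
    have : w * (A * y) ≤ w * (2 * B) := by gcongr
    rw [abs_le]; constructor <;> nlinarith
  have h3' : |t * (A * y - B)| ≤ 2 * w * B := by
    rw [abs_mul, abs_of_nonneg ht0]
    exact (mul_le_of_le_one_left (abs_nonneg _) ht1).trans h3
  have h4 : A * y ^ 2 ≤ (1 + 35 * w) * E := by
    calc A * y ^ 2 = (A * y) * y := by ring
      _ ≤ ((1 + w) * B) * ((1 + 8 * w) * y') := by gcongr
      _ = (1 + w) * (1 + 8 * w) * (B * y') := by ring
      _ ≤ (1 + w) * (1 + 8 * w) * ((1 + w) * E) := by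
          refine mul_le_mul_of_nonneg_left (e2.trans ?_) (by positivity)
          gcongr
      _ = ((1 + w) ^ 2 * (1 + 8 * w)) * E := by ring
      _ ≤ _ := by
          gcongr
          have h2 : w ^ 2 ≤ w := pow_le_of_le_one hw0.le hw1 two_ne_zero
          have h3 : w ^ 3 ≤ w := pow_le_of_le_one hw0.le hw1 three_ne_zero
          linear_combination 17 * h2 + 8 * h3
  have h5 : A * (y - 1) ^ 2 ≤ A - 2 * B + E + 4 * w * B + 35 * w * E := by
    have := (abs_le.1 h3).1
    linear_combination h4 + 2 * this
  have hwA := mul_pos hw0 ha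
  have hwB := mul_pos hw0 hb
  have key : M - ((1 - t) * A + t * B)
      = (M - A * z) + (A * z - ((1 - t) * A + t * (A * y))) + t * (A * y - B) := by ring
  rw [key]
  refine (abs_add_three _ _ _).trans ?_
  linear_combination h1 + h2 + h3' + h5 + 33 * hwA + 25 * hwB

lemma powDivGamma_div_le {x s u : ℝ} (hx : 0 < x) (hs : 0 ≤ s) (hu0 : 0 ≤ u) (hu4 : u ≤ 4) :
    35 / (s + 1) * powDivGamma x (s + u) ≤ 175 / x * powDivGamma x (s + u + 1) := by
  have h := powDivGamma_pos hx (by linarith : 0 ≤ s + u)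
  rw [powDivGamma_add_one hx (by linarith)]
  calc 35 / (s + 1) * powDivGamma x (s + u)
      ≤ 175 / (s + u + 1) * powDivGamma x (s + u) := by
        gcongr ?_ * _
        rw [div_le_div_iff₀ (by linarith) (by linarith)]
        linarith
    _ = _ := by field_simp

lemma continuousOn_powDivGamma {x : ℝ} (hx : 0 < x) :
    ContinuousOn (powDivGamma x) (Set.Ici 0) := by
  intro s hs
  have hs : 0 ≤ s := hs
  have h1 : ContinuousAt Real.Gamma (s + 1) :=
    (Real.differentiableAt_Gamma fun m h => by
      have : (0 : ℝ) ≤ m := m.cast_nonneg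
      linarith).continuousAt
  have h2 : ContinuousAt (fun s : ℝ => Real.Gamma (s + 1)) s :=
    ContinuousAt.comp (f := fun s : ℝ => s + 1) h1 (by fun_prop)
  exact ((Real.continuousAt_const_rpow hx.ne').div h2
    (Real.Gamma_pos_of_pos (by linarith)).ne').continuousWithinAt

/-- The error term of the trapezoid rule for `powDivGamma x` on `[s, s + a]`. -/
noncomputable def trapezoidError (x a s : ℝ) : ℝ :=
  powDivGamma x s - 2 * powDivGamma x (s + a) + powDivGamma x (s + 2 * a) +
    175 / x * (powDivGamma x (s + 1) + powDivGamma x (s + a + 1) + powDivGamma x (s + 2 * a + 1))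

lemma abs_integral_powDivGamma_sub_le {x s a : ℝ} (hx : 0 < x) (hs : 0 ≤ s) (ha0 : 0 < a)
    (ha2 : a ≤ 2) :
    |(∫ u in s..(s + a), powDivGamma x u) - a * ((powDivGamma x s + powDivGamma x (s + a)) / 2)| ≤
      a * trapezoidError x a s := by
  have e : (∫ u in s..(s + a), powDivGamma x u) = a * ∫ t in (0:ℝ)..1, powDivGamma x (s + t * a) := by
    have := intervalIntegral.mul_integral_comp_add_mul (a := 0) (b := 1) (f := powDivGamma x) a s
    simp only [mul_zero, add_zero, mul_one] at this
    rw [← this]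
    simp only [mul_comm]
  have hi : IntervalIntegrable (fun t => powDivGamma x (s + t * a)) MeasureTheory.volume 0 1 := by
    apply ContinuousOn.intervalIntegrable
    refine (continuousOn_powDivGamma hx).comp (by fun_prop) fun t ht => ?_
    rw [Set.uIcc_of_le zero_le_one] at ht
    have := mul_nonneg ht.1 ha0.le
    exact add_nonneg hs this
  have hl : IntervalIntegrable (fun t => (1 - t) * powDivGamma x s + t * powDivGamma x (s + a))
      MeasureTheory.volume 0 1 := Continuous.intervalIntegrable (by fun_prop) _ _
  have e2 : ∫ t in (0:ℝ)..1, ((1 - t) * powDivGamma x s + t * powDivGamma x (s + a))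
      = (powDivGamma x s + powDivGamma x (s + a)) / 2 := by
    rw [intervalIntegral.integral_add (Continuous.intervalIntegrable (by fun_prop) _ _)
      (Continuous.intervalIntegrable (by fun_prop) _ _), intervalIntegral.integral_mul_const,
      intervalIntegral.integral_mul_const, intervalIntegral.integral_sub (by simp) (by simp)]
    simp
    ring
  rw [e, ← e2, ← mul_sub, ← intervalIntegral.integral_sub hi hl, abs_mul, abs_of_pos ha0]
  gcongr
  have := intervalIntegral.norm_integral_le_of_norm_le_const (a := (0:ℝ)) (b := 1)
    (C := trapezoidError x a s) (f := fun t => powDivGamma x (s + t * a) -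
      ((1 - t) * powDivGamma x s + t * powDivGamma x (s + a))) ?_
  · simpa using this
  · intro t ht
    rw [Set.uIoc_of_le zero_le_one] at ht
    refine (abs_powDivGamma_sub_chord_le hx hs ha0 ha2 ht.1.le ht.2).trans ?_
    have h0 := powDivGamma_div_le hx hs le_rfl (by norm_num : (0:ℝ) ≤ 4)
    have h1 := powDivGamma_div_le hx hs ha0.le (by linarith : a ≤ 4)
    have h2 := powDivGamma_div_le hx hs (by linarith : 0 ≤ 2 * a) (by linarith)
    rw [add_zero] at h0
    rw [trapezoidError]
    linarith

lemma powDivGamma_le_floor {x s : ℝ} (hx : 0 < x) (hs : 0 ≤ s) :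
    powDivGamma x s ≤ 2 * powDivGamma x ⌊s⌋₊ + 2 * powDivGamma x (⌊s⌋₊ + 1 : ℕ) := by
  have hk : (0:ℝ) ≤ ⌊s⌋₊ := Nat.cast_nonneg _
  have hd0 : 0 ≤ s - ⌊s⌋₊ := sub_nonneg.2 (Nat.floor_le hs)
  have hd1 : s - ⌊s⌋₊ ≤ 1 := by have := Nat.lt_floor_add_one s; linarith
  have h := (powDivGamma_add_bounds hx hk hd0 (by linarith)).1
  rw [add_sub_cancel] at h
  push_cast
  rw [powDivGamma_add_one hx hk]
  have hp := powDivGamma_pos hx hk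
  have hv : 0 < x / (⌊s⌋₊ + 1) := by positivity
  have hw : 1 / ((⌊s⌋₊ : ℝ) + 1) ≤ 1 := by rw [div_le_one (by linarith)]; linarith
  have hvd : (x / (⌊s⌋₊ + 1)) ^ (s - ⌊s⌋₊) ≤ 1 + x / (⌊s⌋₊ + 1) := by
    have := rpow_one_add_le_one_add_mul_self (s := x / (⌊s⌋₊ + 1) - 1) (by linarith) hd0 hd1
    rw [show 1 + (x / ((⌊s⌋₊ : ℝ) + 1) - 1) = x / (⌊s⌋₊ + 1) by ring] at this
    nlinarith
  refine h.trans ?_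
  calc _ ≤ (1 + 1) * (powDivGamma x ⌊s⌋₊ * (1 + x / (⌊s⌋₊ + 1))) := by gcongr
    _ = _ := by ring

lemma hasSum_powDivGamma_nat (x : ℝ) :
    HasSum (fun k : ℕ => powDivGamma x k) (Real.exp x) := by
  have := NormedSpace.expSeries_div_hasSum_exp (𝔸 := ℝ) x
  rw [← Real.exp_eq_exp_ℝ] at this
  refine this.congr_fun fun k => ?_
  rw [powDivGamma, Real.rpow_natCast, Real.Gamma_nat_eq_factorial]

lemma exists_sum_powDivGamma_le {a c : ℝ} (ha : 0 < a) (hc : 0 ≤ c) :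
    ∃ C, 0 < C ∧ ∀ x, 0 < x → ∀ N : ℕ,
      ∑ n ∈ Finset.range N, powDivGamma x (a * n + c) ≤ C * Real.exp x := by
  obtain ⟨q, hq⟩ := exists_nat_gt (1 / a)
  have hq0 : (0:ℝ) < q := lt_trans (by positivity) hq
  refine ⟨q * 4, by positivity, fun x hx N => ?_⟩
  set g : ℕ → ℝ := fun k => 2 * powDivGamma x k + 2 * powDivGamma x (k + 1 : ℕ) with hg
  have hg0 : ∀ k, 0 ≤ g k := fun k => by
    have := powDivGamma_pos hx (Nat.cast_nonneg k)
    have := powDivGamma_pos hx (Nat.cast_nonneg (k + 1))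
    simp only [hg]; linarith
  have h1 := hasSum_powDivGamma_nat x
  have h2 : Summable fun k : ℕ => powDivGamma x (k + 1 : ℕ) :=
    (summable_nat_add_iff (f := fun k : ℕ => powDivGamma x k) 1).2 h1.summable
  have hgs : Summable g := (h1.summable.mul_left 2).add (h2.mul_left 2)
  have hgt : ∑' k, g k ≤ 4 * Real.exp x := by
    rw [Summable.tsum_add (h1.summable.mul_left 2) (h2.mul_left 2), tsum_mul_left, tsum_mul_left,
      h1.tsum_eq]
    have h3 := h1.summable.tsum_eq_zero_add
    rw [h1.tsum_eq] at h3
    have := powDivGamma_pos hx (Nat.cast_nonneg 0)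
    linarith
  have hfib : ∀ k : ℕ, ((Finset.range N).filter fun n : ℕ => ⌊a * n + c⌋₊ = k).card ≤ q := by
    intro k
    have : ((Finset.range N).filter fun n : ℕ => ⌊a * n + c⌋₊ = k) ⊆
        Finset.Ico ⌈(k - c) / a⌉₊ (⌈(k - c) / a⌉₊ + q) := by
      intro n hn
      rw [Finset.mem_filter] at hn
      have hn0 : (0:ℝ) ≤ a * n + c := by positivity
      obtain ⟨l1, l2⟩ := (Nat.floor_eq_iff hn0).1 hn.2
      rw [Finset.mem_Ico]
      constructor
      · rw [Nat.ceil_le, div_le_iff₀ ha]; linarith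
      · have hh := Nat.le_ceil ((k - c) / a)
        have h5 : (n:ℝ) < (k - c) / a + 1 / a := by
          rw [← add_div, lt_div_iff₀ ha]; linarith
        have : (n:ℝ) < ((⌈(k - c) / a⌉₊ + q : ℕ) : ℝ) := by push_cast; linarith
        exact_mod_cast this
    simpa using Finset.card_le_card this
  calc ∑ n ∈ Finset.range N, powDivGamma x (a * n + c)
      ≤ ∑ n ∈ Finset.range N, g ⌊a * n + c⌋₊ :=
        Finset.sum_le_sum fun n _ => powDivGamma_le_floor hx (by positivity)
    _ = ∑ k ∈ (Finset.range N).image fun n : ℕ => ⌊a * n + c⌋₊,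
          ((Finset.range N).filter fun n : ℕ => ⌊a * n + c⌋₊ = k).card • g k :=
        Finset.sum_comp _ _
    _ ≤ ∑ k ∈ (Finset.range N).image fun n : ℕ => ⌊a * n + c⌋₊, q * g k := by
        refine Finset.sum_le_sum fun k _ => ?_
        rw [nsmul_eq_mul]
        gcongr
        · exact hg0 k
        · exact hfib k
    _ = q * ∑ k ∈ (Finset.range N).image fun n : ℕ => ⌊a * n + c⌋₊, g k := by
        rw [Finset.mul_sum]
    _ ≤ q * ∑' k, g k := by
        gcongr
        exact hgs.sum_le_tsum _ fun k _ => hg0 k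
    _ ≤ q * (4 * Real.exp x) := by gcongr
    _ = _ := by ring

/-- The two-parameter Mittag-Leffler sum `∑ x ^ (a n + c) / Γ(a n + c + 1)`. -/
noncomputable def powDivGammaSum (a c x : ℝ) : ℝ := ∑' n : ℕ, powDivGamma x (a * n + c)

lemma summable_powDivGamma {a c x : ℝ} (ha : 0 < a) (hc : 0 ≤ c) (hx : 0 < x) :
    Summable fun n : ℕ => powDivGamma x (a * n + c) := by
  obtain ⟨C, -, hC⟩ := exists_sum_powDivGamma_le ha hc
  exact summable_of_sum_range_le (fun n => (powDivGamma_pos hx (by positivity)).le) (hC x hx)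

lemma powDivGammaSum_nonneg {a c x : ℝ} (ha : 0 < a) (hc : 0 ≤ c) (hx : 0 < x) :
    0 ≤ powDivGammaSum a c x :=
  tsum_nonneg fun _ => (powDivGamma_pos hx (by positivity)).le

lemma powDivGammaSum_isBigO_exp {a c : ℝ} (ha : 0 < a) (hc : 0 ≤ c) :
    powDivGammaSum a c =O[atTop] Real.exp := by
  obtain ⟨C, -, hC⟩ := exists_sum_powDivGamma_le ha hc
  refine IsBigO.of_bound C ?_
  filter_upwards [eventually_gt_atTop 0] with x hx
  rw [Real.norm_of_nonneg (powDivGammaSum_nonneg ha hc hx), Real.norm_of_nonneg (Real.exp_nonneg x)]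
  exact (summable_powDivGamma ha hc hx).tsum_le_of_sum_range_le (hC x hx)

lemma hasSum_trapezoidError {a c x : ℝ} (ha : 0 < a) (hc : 0 ≤ c) (hx : 0 < x) :
    ∃ T, HasSum (fun n : ℕ => trapezoidError x a (a * n + c)) T ∧
      T ≤ powDivGamma x c + 525 / x * powDivGammaSum a (c + 1) x := by
  have hu := (summable_powDivGamma ha hc hx).hasSum
  have hv := (summable_powDivGamma ha (by linarith : 0 ≤ c + 1) hx).hasSum
  have hu1 := (hasSum_nat_add_iff' 1).2 hu
  have hu2 := (hasSum_nat_add_iff' 2).2 hu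
  have hv1 := (hasSum_nat_add_iff' 1).2 hv
  have hv2 := (hasSum_nat_add_iff' 2).2 hv
  refine ⟨_, (((hu.sub (hu1.mul_left 2)).add hu2).add
    (((hv.add hv1).add hv2).mul_left (175 / x))).congr_fun fun n => ?_, ?_⟩
  · simp only [trapezoidError]
    push_cast
    ring_nf
  · simp only [Finset.sum_range_succ, Finset.sum_range_zero, powDivGammaSum]
    have h1 := powDivGamma_pos hx (by positivity : 0 ≤ a * (1 : ℕ) + c)
    have h2 := powDivGamma_pos hx (by positivity : 0 ≤ a * (0 : ℕ) + (c + 1))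
    have h3 := powDivGamma_pos hx (by positivity : 0 ≤ a * (1 : ℕ) + (c + 1))
    have hw : 0 < 175 / x := by positivity
    have h4 := mul_pos hw h2
    have h5 := mul_pos hw h3
    rw [show a * (0 : ℕ) + c = c by simp] at *
    rw [show 525 / x = 3 * (175 / x) by ring]
    linear_combination h1 + 2 * h4 + h5

lemma integral_powDivGamma_Ioi {a c x : ℝ} (ha : 0 < a) (ha2 : a ≤ 2) (hc : 0 ≤ c) (hx : 0 < x) :
    MeasureTheory.IntegrableOn (powDivGamma x) (Set.Ioi c) ∧
      |(∫ s in Set.Ioi c, powDivGamma x s) - a * powDivGammaSum a c x| ≤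
        a * (2 * powDivGamma x c + 525 / x * powDivGammaSum a (c + 1) x) := by
  have hu := (summable_powDivGamma ha hc hx).hasSum
  have hu1 := (hasSum_nat_add_iff' 1).2 hu
  obtain ⟨T, hT, hTle⟩ := hasSum_trapezoidError ha hc hx
  have hcont : ∀ p q : ℝ, 0 ≤ p → 0 ≤ q →
      IntervalIntegrable (powDivGamma x) MeasureTheory.volume p q := fun p q hp hq =>
    ((continuousOn_powDivGamma hx).mono fun s hs => (le_min hp hq).trans hs.1).intervalIntegrable
  set F : ℕ → ℝ := fun n => ∫ s in (a * n + c)..(a * (n + 1 : ℕ) + c), powDivGamma x s with hF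
  set G : ℕ → ℝ := fun n =>
    a * ((powDivGamma x (a * n + c) + powDivGamma x (a * (n + 1 : ℕ) + c)) / 2) with hG
  have hGs : HasSum G _ := ((hu.add hu1).div_const 2).mul_left a
  have hFG : ∀ n, |F n - G n| ≤ a * trapezoidError x a (a * n + c) := by
    intro n
    have := abs_integral_powDivGamma_sub_le hx (by positivity : 0 ≤ a * (n : ℝ) + c) ha ha2
    rw [show a * (n : ℝ) + c + a = a * (n + 1 : ℕ) + c by push_cast; ring] at this
    exact this
  have hFGs : Summable fun n => F n - G n :=
    Summable.of_norm_bounded (hT.mul_left a).summable hFG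
  have hFs : Summable F := by simpa using hFGs.add hGs.summable
  have hsum : ∀ N : ℕ, ∑ n ∈ Finset.range N, F n = ∫ s in c..(a * N + c), powDivGamma x s := by
    intro N
    have := intervalIntegral.sum_integral_adjacent_intervals (μ := MeasureTheory.volume)
      (f := powDivGamma x) (a := fun n : ℕ => a * n + c) (n := N)
      fun k _ => hcont _ _ (by positivity) (by positivity)
    simpa [hF] using this
  have hlim : Tendsto (fun N : ℕ => a * (N : ℝ) + c) atTop atTop :=
    tendsto_atTop_add_const_right _ _ (tendsto_natCast_atTop_atTop.const_mul_atTop ha)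
  have hFt := hFs.hasSum.tendsto_sum_nat
  simp only [hsum] at hFt
  have hint : MeasureTheory.IntegrableOn (powDivGamma x) (Set.Ioi c) := by
    refine MeasureTheory.integrableOn_Ioi_of_intervalIntegral_norm_bounded (∑' n, F n + 1) c
      (fun N : ℕ => ?_) hlim ?_
    · exact (intervalIntegrable_iff_integrableOn_Ioc_of_le (le_add_of_nonneg_left (by positivity))).1
        (hcont _ _ hc (by positivity))
    · filter_upwards [hFt.eventually (eventually_le_nhds (lt_add_one _))] with N hN
      refine le_trans (le_of_eq ?_) hN
      refine intervalIntegral.integral_congr fun s hs => ?_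
      rw [Set.uIcc_of_le (le_add_of_nonneg_left (by positivity))] at hs
      exact Real.norm_of_nonneg (powDivGamma_pos hx (hc.trans hs.1)).le
  refine ⟨hint, ?_⟩
  have hI : ∫ s in Set.Ioi c, powDivGamma x s = ∑' n, F n :=
    tendsto_nhds_unique (MeasureTheory.intervalIntegral_tendsto_integral_Ioi c hint hlim) hFt
  have h1 : |∑' n, F n - ∑' n, G n| ≤ a * T := by
    rw [← hFs.tsum_sub hGs.summable]
    exact tsum_of_norm_bounded (f := fun n => F n - G n) (hT.mul_left a) hFG
  have h2 : a * powDivGammaSum a c x - ∑' n, G n = a * (powDivGamma x c / 2) := by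
    rw [hGs.tsum_eq, powDivGammaSum]
    simp
    ring
  have h3 := powDivGamma_pos hx hc
  rw [hI]
  calc |∑' n, F n - a * powDivGammaSum a c x|
      = |(∑' n, F n - ∑' n, G n) - a * (powDivGamma x c / 2)| := by rw [← h2]; ring_nf
    _ ≤ |∑' n, F n - ∑' n, G n| + |a * (powDivGamma x c / 2)| := abs_sub _ _
    _ ≤ a * T + a * (powDivGamma x c / 2) := by
        rw [abs_of_nonneg (by positivity : 0 ≤ a * (powDivGamma x c / 2))]
        gcongr
    _ ≤ a * (powDivGamma x c + 525 / x * powDivGammaSum a (c + 1) x)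
          + a * (powDivGamma x c) := by gcongr; linarith
    _ = _ := by ring

lemma rpow_isBigO_rpow_mul_exp (p q : ℝ) :
    (fun x : ℝ => x ^ p) =O[atTop] fun x => x ^ q * Real.exp x := by
  have h := (isLittleO_rpow_exp_atTop (p - q)).isBigO
  refine ((isBigO_refl (fun x : ℝ => x ^ q) atTop).mul h).congr' ?_ EventuallyEq.rfl
  filter_upwards [eventually_gt_atTop 0] with x hx
  rw [← Real.rpow_add hx]
  ring_nf

lemma powDivGamma_isBigO (s : ℝ) :
    (fun x => powDivGamma x s) =O[atTop] fun x => x⁻¹ * Real.exp x := by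
  have h := (rpow_isBigO_rpow_mul_exp s (-1)).const_mul_left (Real.Gamma (s + 1))⁻¹
  refine h.congr' (Eventually.of_forall fun x => ?_) ?_
  · simp only [powDivGamma]; ring
  · filter_upwards [eventually_gt_atTop 0] with x hx
    rw [Real.rpow_neg_one]

lemma integral_powDivGamma_isBigO {c : ℝ} (hc : 0 ≤ c) :
    (fun x => ∫ s in (0:ℝ)..c, powDivGamma x s) =O[atTop] fun x => x⁻¹ * Real.exp x := by
  obtain ⟨M, hM⟩ := isCompact_Icc.exists_bound_of_continuousOn
    ((continuousOn_powDivGamma one_pos).mono (Set.Icc_subset_Ici_self : Set.Icc 0 c ⊆ _))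
  have h := rpow_isBigO_rpow_mul_exp c (-1)
  simp only [Real.rpow_neg_one] at h
  refine IsBigO.trans (IsBigO.of_bound (M * c) ?_) h
  filter_upwards [eventually_ge_atTop 1] with x hx
  have hx0 : 0 < x := by linarith
  have := intervalIntegral.norm_integral_le_of_norm_le_const (a := 0) (b := c)
    (C := M * x ^ c) (f := powDivGamma x) fun s hs => ?_
  · rw [Real.norm_of_nonneg (Real.rpow_nonneg hx0.le c)]
    rw [sub_zero, abs_of_nonneg hc] at this
    linarith
  · rw [Set.uIoc_of_le hc] at hs
    have h1 := hM s ⟨hs.1.le, hs.2⟩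
    have e : powDivGamma x s = powDivGamma 1 s * x ^ s := by
      rw [powDivGamma, powDivGamma, Real.one_rpow]; ring
    rw [e, norm_mul, Real.norm_of_nonneg (Real.rpow_nonneg hx0.le s)]
    have := (norm_nonneg _).trans h1
    gcongr
    exact hs.2

lemma integral_Ioi_sub_powDivGammaSum_isBigO {a c : ℝ} (ha : 0 < a) (ha2 : a ≤ 2) (hc : 0 ≤ c) :
    (fun x => (∫ s in Set.Ioi c, powDivGamma x s) - a * powDivGammaSum a c x)
      =O[atTop] fun x => x⁻¹ * Real.exp x := by
  have h1 : (fun x => a * (2 * powDivGamma x c + 525 / x * powDivGammaSum a (c + 1) x))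
      =O[atTop] fun x => x⁻¹ * Real.exp x := by
    refine (((powDivGamma_isBigO c).const_mul_left 2).add ?_).const_mul_left a
    have := ((isBigO_refl (fun x : ℝ => x⁻¹) atTop).mul
      (powDivGammaSum_isBigO_exp ha (by linarith : 0 ≤ c + 1))).const_mul_left 525
    refine this.congr_left fun x => ?_
    ring
  refine IsBigO.trans (IsBigO.of_bound 1 ?_) h1
  filter_upwards [eventually_gt_atTop 0] with x hx
  rw [one_mul]
  exact ((integral_powDivGamma_Ioi ha ha2 hc hx).2).trans (le_abs_self _)

lemma powDivGammaSum_one_zero (x : ℝ) : powDivGammaSum 1 0 x = Real.exp x := by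
  simpa [powDivGammaSum] using (hasSum_powDivGamma_nat x).tsum_eq

lemma mul_powDivGammaSum_sub_exp_isBigO {a c : ℝ} (ha : 0 < a) (ha2 : a ≤ 2) (hc : 0 ≤ c) :
    (fun x => a * powDivGammaSum a c x - Real.exp x) =O[atTop] fun x => x⁻¹ * Real.exp x := by
  have h1 := integral_Ioi_sub_powDivGammaSum_isBigO ha ha2 hc
  have h2 := integral_Ioi_sub_powDivGammaSum_isBigO one_pos one_le_two le_rfl
  refine ((h2.sub h1).sub (integral_powDivGamma_isBigO hc)).congr' ?_ EventuallyEq.rfl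
  filter_upwards [eventually_gt_atTop 0] with x hx
  rw [powDivGammaSum_one_zero, ← intervalIntegral.integral_interval_add_Ioi
    (integral_powDivGamma_Ioi one_pos one_le_two le_rfl hx).1
    (integral_powDivGamma_Ioi ha ha2 hc hx).1]
  ring

lemma isBigO_mul_sub_one {f g u : ℝ → ℝ} {l : Filter ℝ} (hu : Tendsto u l (nhds 0))
    (hf : (fun s => f s - 1) =O[l] u) (hg : (fun s => g s - 1) =O[l] u) :
    (fun s => f s * g s - 1) =O[l] u := by
  have h1 : (fun s => (f s - 1) * (g s - 1)) =O[l] u := by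
    simpa using hf.mul ((hg.trans_tendsto hu).isBigO_one ℝ)
  refine ((h1.add hf).add hg).congr_left fun s => ?_
  ring

lemma one_add_div_rpow_sub_one_isBigO (b p : ℝ) :
    (fun s : ℝ => (1 + b / s) ^ p - 1) =O[atTop] fun s => s⁻¹ := by
  have h1 : HasDerivAt (fun u : ℝ => (1 + b * u) ^ p) (b * p * (1 + b * 0) ^ (p - 1)) 0 := by
    have := (((hasDerivAt_id (0:ℝ)).const_mul b).const_add 1).rpow_const (p := p) (by simp)
    simpa using this
  have h2 := h1.isBigO_sub.comp_tendsto tendsto_inv_atTop_zero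
  refine h2.congr (fun s => ?_) fun s => ?_
  · simp [div_eq_mul_inv]
  · simp

lemma Gamma_ratio_sub_one_isBigO (b : ℝ) :
    (fun s : ℝ => Real.Gamma (s + b) / (Real.Gamma s * s ^ b) - 1) =O[atTop] fun s => s⁻¹ := by
  have base : ∀ d : ℝ, 0 ≤ d → d ≤ 1 →
      (fun s : ℝ => Real.Gamma (s + d) / (Real.Gamma s * s ^ d) - 1) =O[atTop] fun s => s⁻¹ := by
    intro d hd0 hd1
    refine IsBigO.of_bound 1 ?_
    filter_upwards [eventually_ge_atTop 1] with s hs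
    have hs0 : 0 < s := by linarith
    obtain ⟨h1, h2⟩ := Real.Gamma_add_bounds hs0 hd0 (by linarith)
    have hp : 0 < Real.Gamma s * s ^ d :=
      mul_pos (Real.Gamma_pos_of_pos hs0) (Real.rpow_pos_of_pos hs0 _)
    have hG := Real.Gamma_pos_of_pos (by linarith : 0 < s + d)
    rw [one_div] at h1 h2
    have hi : 0 < s⁻¹ := by positivity
    rw [one_mul, Real.norm_eq_abs, Real.norm_of_nonneg hi.le, div_sub_one hp.ne', abs_div,
      abs_of_pos hp, div_le_iff₀ hp, abs_le]
    have hi1 : s⁻¹ ≤ 1 := inv_le_one_of_one_le₀ hs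
    constructor
    · generalize Real.Gamma s * s ^ d = P at *
      rcases le_total (Real.Gamma (s + d)) P with h | h
      · have := mul_le_mul_of_nonneg_left h hi.le
        linarith
      · have := mul_pos hi hp
        linarith
    · linarith
  have up : ∀ d : ℝ,
      (fun s : ℝ => Real.Gamma (s + d) / (Real.Gamma s * s ^ d) - 1) =O[atTop] (fun s => s⁻¹) →
      (fun s : ℝ => Real.Gamma (s + (d + 1)) / (Real.Gamma s * s ^ (d + 1)) - 1)
        =O[atTop] fun s => s⁻¹ := by
    intro d hd
    refine (isBigO_mul_sub_one tendsto_inv_atTop_zero hd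
      (one_add_div_rpow_sub_one_isBigO d 1)).congr' ?_ EventuallyEq.rfl
    filter_upwards [eventually_gt_atTop 0, eventually_gt_atTop (-d)] with s hs hsd
    have h1 := (Real.Gamma_pos_of_pos hs).ne'
    have h2 := (Real.rpow_pos_of_pos hs d).ne'
    rw [← add_assoc, Real.Gamma_add_one (by linarith), Real.rpow_add_one hs.ne', Real.rpow_one]
    field_simp
  have down : ∀ d : ℝ,
      (fun s : ℝ => Real.Gamma (s + d) / (Real.Gamma s * s ^ d) - 1) =O[atTop] (fun s => s⁻¹) →
      (fun s : ℝ => Real.Gamma (s + (d - 1)) / (Real.Gamma s * s ^ (d - 1)) - 1)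
        =O[atTop] fun s => s⁻¹ := by
    intro d hd
    refine (isBigO_mul_sub_one tendsto_inv_atTop_zero hd
      (one_add_div_rpow_sub_one_isBigO (d - 1) (-1))).congr' ?_ EventuallyEq.rfl
    filter_upwards [eventually_gt_atTop 0, eventually_gt_atTop (1 - d)] with s hs hsd
    have h1 := (Real.Gamma_pos_of_pos hs).ne'
    have h2 := (Real.rpow_pos_of_pos hs (d - 1)).ne'
    have h3 : s + (d - 1) ≠ 0 := by linarith
    have e1 : s + d = s + (d - 1) + 1 := by ring
    have e2 : s ^ d = s ^ (d - 1) * s := by rw [← Real.rpow_add_one hs.ne']; ring_nf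
    rw [e1, Real.Gamma_add_one h3, e2, Real.rpow_neg_one,
      show 1 + (d - 1) / s = (s + (d - 1)) / s by field_simp]
    field_simp
  have hint : ∀ k : ℤ, (fun s : ℝ => Real.Gamma (s + (Int.fract b + k)) /
      (Real.Gamma s * s ^ (Int.fract b + k)) - 1) =O[atTop] fun s => s⁻¹ := by
    intro k
    induction k using Int.induction_on with
    | zero => simpa using base _ (Int.fract_nonneg b) (Int.fract_lt_one b).le
    | succ i ih => simpa [add_assoc] using up _ ih
    | pred i ih => simpa [add_sub_assoc] using down _ ih
  simpa using hint ⌊b⌋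

lemma mittagLeffler_coeff_isBigO (b e : ℝ) :
    (fun s : ℝ => Real.Gamma (s + b) / Real.Gamma s * (s + e) ^ (-b) - 1)
      =O[atTop] fun s => s⁻¹ := by
  refine (isBigO_mul_sub_one tendsto_inv_atTop_zero (Gamma_ratio_sub_one_isBigO b)
    (one_add_div_rpow_sub_one_isBigO e (-b))).congr' ?_ EventuallyEq.rfl
  filter_upwards [eventually_gt_atTop 0, eventually_gt_atTop (-e)] with s hs hse
  have h1 := (Real.Gamma_pos_of_pos hs).ne'
  have h2 := (Real.rpow_pos_of_pos hs b).ne'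
  have h3 : 0 < 1 + e / s := by
    rw [show 1 + e / s = (s + e) / s by field_simp]
    exact div_pos (by linarith) hs
  have e1 : s + e = s * (1 + e / s) := by field_simp
  rw [e1, Real.mul_rpow hs.le h3.le, Real.rpow_neg hs.le]
  field_simp

/-- The terms of the Barnes series, with argument `x ^ α`, are eventually close to shifted terms
of the Mittag-Leffler series. -/
lemma exists_abs_barnes_term_sub_le {α θ : ℝ} (β : ℝ) (hα : 0 < α) (hθ : 0 < θ) :
    ∃ K : ℝ, ∃ N : ℕ, 0 ≤ α * N + β ∧ ∀ n ≥ N, ∀ x, 0 < x →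
      |x ^ (α * n) / (((n : ℝ) + θ) ^ β * Real.Gamma (α * n + 1)) -
          α ^ β * x ^ (-β) * powDivGamma x (α * n + β)| ≤
        K * x ^ (-β - 1) * powDivGamma x (α * n + β + 1) := by
  obtain ⟨K, hK0, hK⟩ := (mittagLeffler_coeff_isBigO β (α * θ - 1)).exists_pos
  obtain ⟨S, hS⟩ := eventually_atTop.1 hK.bound
  obtain ⟨N, hN⟩ := exists_nat_gt ((|S| + |β|) / α)
  rw [div_lt_iff₀ hα] at hN
  have hN' : |S| + |β| < α * N := by linarith
  have hSa := abs_nonneg S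
  have hβa := neg_abs_le β
  refine ⟨2 * K * α ^ β, N, by linarith, fun n hn x hx => ?_⟩
  have hnN : α * N ≤ α * n := by gcongr
  have hs : S ≤ α * n + 1 := by have := le_abs_self S; linarith [abs_nonneg β]
  have h := hS _ hs
  have hs0 : 0 < α * n + 1 := by positivity
  have hsb : 0 ≤ α * n + β := by linarith
  have hG := Real.Gamma_pos_of_pos hs0
  have hGb := Real.Gamma_pos_of_pos (by linarith : 0 < α * n + β + 1)
  rw [Real.norm_eq_abs, Real.norm_of_nonneg (by positivity)] at h
  rw [show α * (n:ℝ) + 1 + (α * θ - 1) = α * (n + θ) by ring,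
    show α * (n:ℝ) + 1 + β = α * n + β + 1 by ring] at h
  set q := Real.Gamma (α * n + β + 1) / Real.Gamma (α * n + 1) * (α * (n + θ)) ^ (-β) with hq
  have hα' := Real.rpow_pos_of_pos hα β
  have hnθ := Real.rpow_pos_of_pos (by positivity : 0 < (n:ℝ) + θ) β
  have hxb := Real.rpow_pos_of_pos hx β
  have hp := powDivGamma_pos hx hsb
  have e1 : x ^ (α * n) / (((n : ℝ) + θ) ^ β * Real.Gamma (α * n + 1))
      = α ^ β * x ^ (-β) * powDivGamma x (α * n + β) * q := by
    rw [hq, powDivGamma, Real.mul_rpow hα.le (by positivity), Real.rpow_neg hα.le,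
      Real.rpow_neg hx.le, Real.rpow_neg (by positivity : 0 ≤ (n : ℝ) + θ), Real.rpow_add hx]
    field_simp
  have hxn := Real.rpow_pos_of_pos hx (-β)
  rw [e1, ← mul_sub_one, abs_mul, abs_of_pos (by positivity), powDivGamma_add_one hx hsb,
    Real.rpow_sub_one hx.ne']
  have hinv : (α * n + 1)⁻¹ ≤ 2 / (α * n + β + 1) := by
    rw [inv_eq_one_div, div_le_div_iff₀ hs0 (by linarith)]
    have := le_abs_self β
    linarith
  calc α ^ β * x ^ (-β) * powDivGamma x (α * n + β) * |q - 1|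
      ≤ α ^ β * x ^ (-β) * powDivGamma x (α * n + β) * (K * (2 / (α * n + β + 1))) := by
        gcongr
        exact h.trans (by gcongr)
    _ = _ := by field_simp

lemma barnes_series_isBigO {α θ : ℝ} (β : ℝ) (hα : 0 < α) (hα2 : α ≤ 2) (hθ : 0 < θ) :
    (fun x : ℝ => ∑' n : ℕ, x ^ (α * n) / (((n : ℝ) + θ) ^ β * Real.Gamma (α * n + 1)) -
      α ^ (β - 1) * x ^ (-β) * Real.exp x) =O[atTop] fun x => x ^ (-β - 1) * Real.exp x := by
  obtain ⟨K, N, hc, hterm⟩ := exists_abs_barnes_term_sub_le β hα hθ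
  set c := α * N + β with hcdef
  set w : ℝ → ℕ → ℝ := fun x n =>
    x ^ (α * n) / (((n : ℝ) + θ) ^ β * Real.Gamma (α * n + 1)) with hw
  have hc1 : 0 ≤ c + 1 := by linarith
  have hterm' : ∀ x, 0 < x → ∀ m : ℕ,
      |w x (m + N) - α ^ β * x ^ (-β) * powDivGamma x (α * m + c)| ≤
        K * x ^ (-β - 1) * powDivGamma x (α * m + (c + 1)) := by
    intro x hx m
    have := hterm (m + N) (Nat.le_add_left _ _) x hx
    rw [show α * ((m + N : ℕ) : ℝ) + β = α * m + c by rw [hcdef]; push_cast; ring, add_assoc _ c]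
      at this
    exact this
  have hdiff : ∀ x, 0 < x →
      Summable fun m : ℕ => w x (m + N) - α ^ β * x ^ (-β) * powDivGamma x (α * m + c) :=
    fun x hx => Summable.of_norm_bounded ((summable_powDivGamma hα hc1 hx).mul_left _) (hterm' x hx)
  have hmain : ∀ x, 0 < x →
      Summable fun m : ℕ => α ^ β * x ^ (-β) * powDivGamma x (α * m + c) :=
    fun x hx => (summable_powDivGamma hα hc hx).mul_left _
  have htail : ∀ x, 0 < x → Summable fun m : ℕ => w x (m + N) := fun x hx => by
    simpa using (hdiff x hx).add (hmain x hx)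
  have h1 : (fun x => ∑' m : ℕ, w x (m + N) - α ^ β * x ^ (-β) * powDivGammaSum α c x)
      =O[atTop] fun x => x ^ (-β - 1) * Real.exp x := by
    have hO := ((isBigO_refl (fun x : ℝ => x ^ (-β - 1)) atTop).mul
      (powDivGammaSum_isBigO_exp hα hc1)).const_mul_left K
    refine IsBigO.trans (IsBigO.of_bound 1 ?_) hO
    filter_upwards [eventually_gt_atTop 0] with x hx
    rw [powDivGammaSum, ← tsum_mul_left, ← (htail x hx).tsum_sub (hmain x hx), one_mul]
    refine le_trans ?_ (le_abs_self _)
    refine tsum_of_norm_bounded ?_ (hterm' x hx)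
    rw [← mul_assoc]
    exact (summable_powDivGamma hα hc1 hx).hasSum.mul_left _
  have h2 : (fun x => α ^ β * x ^ (-β) * powDivGammaSum α c x -
      α ^ (β - 1) * x ^ (-β) * Real.exp x) =O[atTop] fun x => x ^ (-β - 1) * Real.exp x := by
    have hO := ((isBigO_refl (fun x : ℝ => x ^ (-β)) atTop).mul
      (mul_powDivGammaSum_sub_exp_isBigO hα hα2 hc)).const_mul_left (α ^ (β - 1))
    refine hO.congr' (Eventually.of_forall fun x => ?_) ?_
    · simp only
      rw [show α ^ β = α ^ (β - 1) * α by rw [← Real.rpow_add_one hα.ne']; ring_nf]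
      ring
    · filter_upwards [eventually_gt_atTop 0] with x hx
      rw [Real.rpow_sub_one hx.ne']
      ring
  have h3 : (fun x => ∑ n ∈ Finset.range N, w x n) =O[atTop]
      fun x => x ^ (-β - 1) * Real.exp x := by
    refine IsBigO.fun_sum fun n _ => ?_
    refine ((rpow_isBigO_rpow_mul_exp (α * n) (-β - 1)).const_mul_left
      (((n : ℝ) + θ) ^ β * Real.Gamma (α * n + 1))⁻¹).congr_left fun x => ?_
    simp only [hw]
    ring
  refine ((h1.add h2).add h3).congr' ?_ EventuallyEq.rfl
  filter_upwards [eventually_gt_atTop 0] with x hx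
  have := ((summable_nat_add_iff N).1 (htail x hx)).sum_add_tsum_nat_add N
  rw [← this]
  ring

/-- **Barnes' asymptotics** for the generalized Mittag-Leffler functions
`E_α(z;θ,β) = Σ_{n≥0} z^n / ((n+θ)^β Γ(αn+1))`: for `0 < α ≤ 2`,
`E_α(r;θ,β) = α^(β-1) r^(-β/α) e^(r^(1/α)) (1 + O(r^(-1/α)))` as `r → +∞`;
in particular `E_α(r;θ,β) ≤ C r^(-β/α) e^(r^(1/α))` for all large `r`. -/
theorem mittagLeffler_asymptotics (α θ β : ℝ) (hα1 : 0 < α) (hα2 : α ≤ 2) (hθ : 0 < θ)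
    (E : ℝ → ℝ)
    (hE : ∀ r : ℝ, E r = ∑' n : ℕ, r ^ n / (((n : ℝ) + θ) ^ β * Real.Gamma (α * n + 1))) :
    (∃ g : ℝ → ℝ,
      (∀ᶠ r in atTop, E r =
        α ^ (β - 1) * r ^ (-(β / α)) * Real.exp (r ^ (1 / α)) * (1 + g r)) ∧
      g =O[atTop] fun r : ℝ => r ^ (-(1 / α))) ∧
    ∃ C : ℝ, 0 < C ∧ ∃ R : ℝ, 0 < R ∧ ∀ r ≥ R,
      E r ≤ C * r ^ (-(β / α)) * Real.exp (r ^ (1 / α)) := by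
  have hA : 0 < α ^ (β - 1) := Real.rpow_pos_of_pos hα1 _
  have hinv : 0 < 1 / α := by positivity
  obtain ⟨g, hg, hgO⟩ : ∃ g : ℝ → ℝ,
      (∀ᶠ r in atTop, E r =
        α ^ (β - 1) * r ^ (-(β / α)) * Real.exp (r ^ (1 / α)) * (1 + g r)) ∧
      g =O[atTop] fun r : ℝ => r ^ (-(1 / α)) := by
    have hO := (barnes_series_isBigO β hα1 hα2 hθ).comp_tendsto (tendsto_rpow_atTop hinv)
    refine ⟨fun r => E r / (α ^ (β - 1) * r ^ (-(β / α)) * Real.exp (r ^ (1 / α))) - 1, ?_, ?_⟩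
    · filter_upwards [eventually_gt_atTop 0] with r hr
      have := Real.rpow_pos_of_pos hr (-(β / α))
      have := Real.exp_pos (r ^ (1 / α))
      field_simp
      ring
    · have h2 := hO.mul (isBigO_refl
        (fun r : ℝ => (α ^ (β - 1) * r ^ (-(β / α)) * Real.exp (r ^ (1 / α)))⁻¹) atTop)
      refine IsBigO.trans (h2.congr' ?_ ?_)
        ((isBigO_refl (fun r : ℝ => r ^ (-(1 / α))) atTop).const_mul_left (α ^ (β - 1))⁻¹)
      · filter_upwards [eventually_gt_atTop 0] with r hr
        have h3 := Real.rpow_pos_of_pos hr (-(β / α))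
        have h4 := Real.exp_pos (r ^ (1 / α))
        have e1 : ∀ n : ℕ, (r ^ (1 / α)) ^ (α * n) = r ^ n := fun n => by
          rw [← Real.rpow_mul hr.le, ← mul_assoc, one_div_mul_cancel hα1.ne', one_mul,
            Real.rpow_natCast]
        have e2 : (r ^ (1 / α)) ^ (-β) = r ^ (-(β / α)) := by
          rw [← Real.rpow_mul hr.le]; ring_nf
        simp only [Function.comp_apply, e1, e2, ← hE]
        field_simp
      · filter_upwards [eventually_gt_atTop 0] with r hr
        have h3 := Real.rpow_pos_of_pos hr (-(β / α))
        have h4 := Real.exp_pos (r ^ (1 / α))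
        have e2 : (r ^ (1 / α)) ^ (-β - 1) = r ^ (-(β / α)) * r ^ (-(1 / α)) := by
          rw [← Real.rpow_mul hr.le, ← Real.rpow_add hr]; ring_nf
        simp only [Function.comp_apply, e2]
        field_simp
  refine ⟨⟨g, hg, hgO⟩, ?_⟩
  have hg0 : Tendsto g atTop (nhds 0) := hgO.trans_tendsto (tendsto_rpow_neg_atTop hinv)
  obtain ⟨R, hR⟩ := eventually_atTop.1 (hg.and (hg0.eventually (eventually_le_nhds one_pos)))
  refine ⟨2 * α ^ (β - 1), by positivity, max R 1, by positivity, fun r hr => ?_⟩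
  obtain ⟨h1, h2⟩ := hR r ((le_max_left _ _).trans hr)
  have hr0 : 0 < r := by linarith [le_max_right R 1]
  rw [h1]
  calc _ ≤ α ^ (β - 1) * r ^ (-(β / α)) * Real.exp (r ^ (1 / α)) * 2 := by gcongr; linarith
    _ = _ := by ring
end
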